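/- arXiv:2411.10207 — 2 statements merged into one kernel-verified Lean document; each statement's English description precedes it below -/
import Mathlib

section
/- Every tetromino fence has enclosed area at most 9. -/
/-- Cells of the square lattice. -/
abbrev Cell : Type := ℤ × ℤ

/-- Two cells are adjacent if they differ by (±1,0) or (0,±1). -/
def Adj (p q : Cell) : Prop := (p.1 - q.1).natAbs + (p.2 - q.2).natAbs = 1

/-- `q` is reachable from `p` by a path of adjacent cells inside `S`. -/
def ReachIn (S : Set Cell) (p q : Cell) : Prop :=
  Relation.ReflTransGen (fun x y => Adj x y ∧ x ∈ S ∧ y ∈ S) p q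

/-- A set of cells is connected if any two of its cells are joined by a path
of adjacent cells inside the set. -/
def SetConnected (S : Set Cell) : Prop := ∀ p ∈ S, ∀ q ∈ S, ReachIn S p q

/-- The connected component of `c` in `S` under adjacency. -/
def component (S : Set Cell) (c : Cell) : Set Cell := {d | ReachIn S c d}

/-- A cell `c ∉ F` is enclosed by `F` if its connected component in the
complement of `F` is finite. -/
def Enclosed (F : Set Cell) (c : Cell) : Prop := c ∉ F ∧ (component Fᶜ c).Finite

/-- The enclosed area of `F` is the number of cells enclosed by `F`. -/
noncomputable def encArea (F : Set Cell) : ℕ := Set.ncard {c | Enclosed F c}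

/-- The eight symmetries of the square lattice (rotations by multiples of 90°
and reflections). -/
def symms : List (Cell → Cell) :=
  [fun p => (p.1, p.2), fun p => (-p.2, p.1), fun p => (-p.1, -p.2), fun p => (p.2, -p.1),
   fun p => (p.1, -p.2), fun p => (-p.1, p.2), fun p => (p.2, p.1), fun p => (-p.2, -p.1)]

/-- `Q` is a placement of the polyomino `P`: the image of `P` under a composition
of one of the eight symmetries of the square lattice with a translation. -/
def IsPlacement (P Q : Set Cell) : Prop :=
  ∃ f ∈ symms, ∃ t : Cell, Q = (fun c => f c + t) '' P

/-- Two pieces are edge-adjacent if some cell of one is adjacent to a cell of the other. -/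
def PieceAdj (A B : Set Cell) : Prop := ∃ a ∈ A, ∃ b ∈ B, Adj a b

/-- The five free tetrominoes I, L, N, O, T. -/
def tets : Fin 5 → Set Cell :=
  ![{(0,0), (0,1), (0,2), (0,3)},
    {(0,0), (1,0), (0,1), (0,2)},
    {(0,0), (1,0), (1,1), (2,1)},
    {(0,0), (1,0), (0,1), (1,1)},
    {(0,0), (1,0), (2,0), (1,1)}]

/-- A tetromino fence: five pairwise disjoint placements, one of each free
tetromino, whose union is connected, each piece being edge-adjacent to at
least two of the other pieces. -/
structure TetFence where
  piece : Fin 5 → Set Cell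
  placement : ∀ i, IsPlacement (tets i) (piece i)
  disj : Pairwise fun i j => Disjoint (piece i) (piece j)
  conn : SetConnected (⋃ i, piece i)
  adj2 : ∀ i, 2 ≤ Set.ncard {j | j ≠ i ∧ PieceAdj (piece i) (piece j)}

/-- The enclosed area of a tetromino fence. -/
noncomputable def TetFence.area (F : TetFence) : ℕ := encArea (⋃ i, F.piece i)


namespace TFence
open Finset

instance adjDec : DecidableRel Adj := fun p q => by unfold Adj; infer_instance

/-- The four unit directions. -/
def dirs : Finset Cell := {(1,0), (-1,0), (0,1), (0,-1)}

/-- Cells of `S` whose neighbour in direction `d` is not in `S`. -/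
def bd (S : Finset Cell) (d : Cell) : Finset Cell := S.filter fun c => c + d ∉ S

/-- Perimeter. -/
def per (S : Finset Cell) : ℕ := ∑ d ∈ dirs, (bd S d).card

lemma per_eq (S : Finset Cell) :
    per S = (bd S (1,0)).card + (bd S (-1,0)).card + (bd S (0,1)).card + (bd S (0,-1)).card := by
  unfold per dirs
  rw [Finset.sum_insert (by decide), Finset.sum_insert (by decide), Finset.sum_insert (by decide),
    Finset.sum_singleton]
  ring

lemma neg_mem_dirs {d : Cell} (h : d ∈ dirs) : -d ∈ dirs := by
  simp only [dirs, mem_insert, mem_singleton] at h ⊢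
  rcases h with rfl | rfl | rfl | rfl <;> simp

lemma adj_add {c d : Cell} (h : d ∈ dirs) : Adj c (c + d) := by
  simp only [dirs, mem_insert, mem_singleton] at h
  unfold Adj
  rcases h with rfl | rfl | rfl | rfl <;> simp

lemma adj_dir {c c' : Cell} (h : Adj c c') : c' - c ∈ dirs := by
  obtain ⟨a, b⟩ := c
  obtain ⟨a', b'⟩ := c'
  simp only [Adj] at h
  simp only [dirs, mem_insert, mem_singleton, Prod.mk_sub_mk, Prod.mk.injEq]
  omega

lemma dot_pos {d : Cell} (h : d ∈ dirs) : d.1 * d.1 + d.2 * d.2 = 1 := by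
  simp only [dirs, mem_insert, mem_singleton] at h
  rcases h with rfl | rfl | rfl | rfl <;> simp

/-- Walking from a cell of `S` in direction `d` one meets the boundary. -/
lemma exists_bd {S : Finset Cell} {d c : Cell} (hd : d ∈ dirs) (π : Cell → ℤ)
    (hπ : ∀ c, π (c + d) = π c) (hc : c ∈ S) :
    ∃ e ∈ bd S d, π e = π c ∧ c.1 * d.1 + c.2 * d.2 ≤ e.1 * d.1 + e.2 * d.2 := by
  obtain ⟨e, he, hm⟩ := Finset.exists_max_image (S.filter fun e => π e = π c)
    (fun e => e.1 * d.1 + e.2 * d.2) ⟨c, by simp [hc]⟩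
  rw [mem_filter] at he
  refine ⟨e, ?_, he.2, hm c (by simp [hc])⟩
  simp only [bd, mem_filter]
  refine ⟨he.1, fun h => ?_⟩
  have := hm (e + d) (by simp [h, hπ, he.2])
  have h1 := dot_pos hd
  simp only [Prod.fst_add, Prod.snd_add] at this
  nlinarith

lemma bd_card {S : Finset Cell} {d : Cell} (hd : d ∈ dirs) (π : Cell → ℤ)
    (hπ : ∀ c, π (c + d) = π c) : (S.image π).card ≤ (bd S d).card := by
  refine le_trans (Finset.card_le_card ?_) (Finset.card_image_le (f := π))
  intro y hy
  obtain ⟨c, hc, rfl⟩ := mem_image.1 hy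
  obtain ⟨e, he, h, -⟩ := exists_bd hd π hπ hc
  exact mem_image.2 ⟨e, he, h⟩

lemma per_ge (S : Finset Cell) :
    2 * ((S.image Prod.fst).card + (S.image Prod.snd).card) ≤ per S := by
  rw [per_eq]
  have h1 := bd_card (S := S) (d := (1,0)) (by decide) Prod.snd (by simp)
  have h2 := bd_card (S := S) (d := (-1,0)) (by decide) Prod.snd (by simp)
  have h3 := bd_card (S := S) (d := (0,1)) (by decide) Prod.fst (by simp)
  have h4 := bd_card (S := S) (d := (0,-1)) (by decide) Prod.fst (by simp)
  omega

lemma card_le_proj (S : Finset Cell) :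
    S.card ≤ (S.image Prod.fst).card * (S.image Prod.snd).card := by
  rw [← Finset.card_product]
  exact Finset.card_le_card fun c hc => mem_product.2
    ⟨mem_image_of_mem _ hc, mem_image_of_mem _ hc⟩

lemma per_split (S : Finset Cell) (p : Cell → Prop) [DecidablePred p]
    (h : ∀ c ∈ S, ∀ d ∈ dirs, c + d ∈ S → (p c ↔ p (c + d))) :
    per (S.filter p) + per (S.filter fun c => ¬ p c) ≤ per S := by
  unfold per
  rw [← Finset.sum_add_distrib]
  refine Finset.sum_le_sum fun d hd => ?_
  rw [← Finset.card_union_of_disjoint]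
  · refine Finset.card_le_card fun c hc => ?_
    simp only [bd, mem_union, mem_filter, not_and] at hc ⊢
    rcases hc with ⟨⟨h1, h2⟩, h3⟩ | ⟨⟨h1, h2⟩, h3⟩
    · exact ⟨h1, fun h4 => h3 h4 ((h c h1 d hd h4).1 h2)⟩
    · exact ⟨h1, fun h4 => h3 h4 (fun h5 => h2 ((h c h1 d hd h4).2 h5))⟩
  · rw [Finset.disjoint_left]
    intro c h1 h2
    simp only [bd, mem_filter] at h1 h2
    exact h2.1.2 h1.1.2

/-- The outer and inner perimeters together are at most the perimeter of the fence. -/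
lemma per_union (F E : Finset Cell) (hdisj : Disjoint F E)
    (hE : ∀ c ∈ E, ∀ d ∈ dirs, c + d ∈ F ∪ E) : per (F ∪ E) + per E ≤ per F := by
  have key : ∀ d ∈ dirs, (bd (F ∪ E) d).card + (bd E (-d)).card ≤ (bd F d).card := by
    intro d hd
    have hinj : ((bd E (-d)).image (· + -d)).card = (bd E (-d)).card :=
      Finset.card_image_of_injective _ (add_left_injective _)
    rw [← hinj, ← Finset.card_union_of_disjoint]
    · refine Finset.card_le_card fun c hc => ?_
      rw [mem_union] at hc
      rcases hc with hc | hc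
      · simp only [bd, mem_filter] at hc ⊢
        have h2 : c ∉ E := fun h => hc.2 (hE c h d hd)
        refine ⟨(mem_union.1 hc.1).resolve_right h2, fun h => hc.2 (mem_union_left _ h)⟩
      · obtain ⟨e, he, rfl⟩ := mem_image.1 hc
        simp only [bd, mem_filter] at he ⊢
        refine ⟨(mem_union.1 (hE e he.1 _ (neg_mem_dirs hd))).resolve_right he.2, ?_⟩
        rw [neg_add_cancel_right]
        exact fun h => Finset.disjoint_left.1 hdisj h he.1
    · rw [Finset.disjoint_left]
      intro c h1 h2
      obtain ⟨e, he, rfl⟩ := mem_image.1 h2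
      simp only [bd, mem_filter] at he h1
      rw [neg_add_cancel_right] at h1
      exact h1.2 (mem_union_right _ he.1)
  have h1 := key (1,0) (by decide)
  have h2 := key (-1,0) (by decide)
  have h3 := key (0,1) (by decide)
  have h4 := key (0,-1) (by decide)
  simp only [Prod.neg_mk, neg_neg, neg_zero] at h1 h2 h3 h4
  rw [per_eq, per_eq, per_eq]
  omega

/-- Ordered pairs of adjacent cells. -/
def apairs (S T : Finset Cell) : Finset (Cell × Cell) := (S ×ˢ T).filter fun x => Adj x.1 x.2

lemma per_add_apairs (F : Finset Cell) : per F + (apairs F F).card ≤ 4 * F.card := by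
  have h1 : (apairs F F).card ≤ ∑ d ∈ dirs, (F.filter fun c => c + d ∈ F).card := by
    rw [← Finset.card_sigma]
    refine Finset.card_le_card_of_injOn (fun x => ⟨x.2 - x.1, x.1⟩) ?_ ?_
    · rintro ⟨a, b⟩ hx
      simp only [apairs, mem_coe, mem_filter, mem_product] at hx
      simp only [coe_sigma, Set.mem_sigma_iff, mem_coe, mem_filter, add_sub_cancel]
      exact ⟨adj_dir hx.2, hx.1⟩
    · rintro ⟨a, b⟩ - ⟨a', b'⟩ - h
      simp only [Sigma.mk.injEq, heq_eq_eq] at h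
      obtain ⟨h1, rfl⟩ := h
      rw [sub_left_inj] at h1
      rw [h1]
  have h2 : per F + ∑ d ∈ dirs, (F.filter fun c => c + d ∈ F).card = 4 * F.card := by
    unfold per bd
    rw [← Finset.sum_add_distrib]
    rw [Finset.sum_congr rfl (g := fun _ => F.card)]
    · simp [dirs]
    · intro d _
      rw [add_comm]
      exact Finset.card_filter_add_card_filter_not (fun c => c + d ∈ F)
  omega

/-- Cells of the tetrominoes. -/
def tetC : Fin 5 → Finset Cell :=
  ![{(0,0), (0,1), (0,2), (0,3)},
    {(0,0), (1,0), (0,1), (0,2)},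
    {(0,0), (1,0), (1,1), (2,1)},
    {(0,0), (1,0), (0,1), (1,1)},
    {(0,0), (1,0), (2,0), (1,1)}]

lemma tets_eq (i : Fin 5) : tets i = ↑(tetC i) := by
  fin_cases i <;> simp [tets, tetC]

lemma card_sym : ∀ f ∈ symms, ∀ i, ((tetC i).image f).card = 4 := by decide +kernel

lemma apairs_sym : ∀ f ∈ symms, ∀ i,
    (if i = 3 then 8 else 6) ≤ (apairs ((tetC i).image f) ((tetC i).image f)).card := by
  decide +kernel

lemma apairs_shift (Q : Finset Cell) (t : Cell) :
    (apairs Q Q).card ≤ (apairs (Q.image (· + t)) (Q.image (· + t))).card := by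
  refine Finset.card_le_card_of_injOn (fun x => (x.1 + t, x.2 + t)) ?_ ?_
  · rintro ⟨a, b⟩ hx
    simp only [apairs, mem_coe, mem_filter, mem_product] at hx ⊢
    refine ⟨⟨mem_image_of_mem _ hx.1.1, mem_image_of_mem _ hx.1.2⟩, ?_⟩
    simpa [Adj] using hx.2
  · rintro ⟨a, b⟩ - ⟨a', b'⟩ - h
    simpa using h

lemma apairs_total (p : Fin 5 → Finset Cell) (hd : ∀ i j, i ≠ j → Disjoint (p i) (p j))
    (hs : ∀ i, (if i = 3 then 8 else 6) ≤ (apairs (p i) (p i)).card)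
    (hadj : ∀ i, ∃ j k, j ≠ i ∧ k ≠ i ∧ j ≠ k ∧ (apairs (p i) (p j)).Nonempty ∧
      (apairs (p i) (p k)).Nonempty) :
    42 ≤ (apairs (univ.biUnion p) (univ.biUnion p)).card := by
  have h1 : ∑ x : Fin 5 × Fin 5, (apairs (p x.1) (p x.2)).card ≤
      (apairs (univ.biUnion p) (univ.biUnion p)).card := by
    rw [← Finset.card_biUnion]
    · refine Finset.card_le_card fun x hx => ?_
      simp only [mem_biUnion, apairs, mem_filter, mem_product, mem_univ, true_and] at hx ⊢
      obtain ⟨a, h, h'⟩ := hx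
      exact ⟨⟨⟨_, h.1⟩, ⟨_, h.2⟩⟩, h'⟩
    · rintro ⟨i, j⟩ - ⟨i', j'⟩ - hne
      rw [Function.onFun, Finset.disjoint_left]
      rintro ⟨a, b⟩ h1 h2
      simp only [apairs, mem_filter, mem_product] at h1 h2
      apply hne
      have e1 : i = i' := by
        by_contra h
        exact Finset.disjoint_left.1 (hd _ _ h) h1.1.1 h2.1.1
      have e2 : j = j' := by
        by_contra h
        exact Finset.disjoint_left.1 (hd _ _ h) h1.1.2 h2.1.2
      rw [e1, e2]
  rw [Fintype.sum_prod_type] at h1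
  have h2 : ∀ i, (if i = 3 then 8 else 6) + 2 ≤ ∑ j, (apairs (p i) (p j)).card := by
    intro i
    obtain ⟨j, k, hj, hk, hjk, h1, h2⟩ := hadj i
    have := Finset.sum_le_sum_of_subset (f := fun j => (apairs (p i) (p j)).card)
      (Finset.subset_univ ({i, j, k} : Finset (Fin 5)))
    rw [Finset.sum_insert (by simp [hj.symm, hk.symm]), Finset.sum_insert (by simp [hjk]),
      Finset.sum_singleton] at this
    have := hs i
    have := h1.card_pos
    have := h2.card_pos
    omega
  have h3 := Finset.sum_le_sum (s := univ) fun i _ => h2 i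
  have h4 : ∑ i : Fin 5, ((if i = 3 then 8 else 6) + 2) = 42 := by decide
  rw [h4] at h3
  exact h3.trans h1

lemma interval_of_conn {S : Finset Cell} (hc : SetConnected (S : Set Cell)) (π : Cell → ℤ)
    (hπ : ∀ a b, Adj a b → π b ≤ π a + 1) {a b : Cell} (ha : a ∈ S) (hb : b ∈ S) {x : ℤ}
    (h1 : π a ≤ x) (h2 : x ≤ π b) : x ∈ S.image π := by
  have := hc a (by simpa using ha) b (by simpa using hb)
  unfold ReachIn at this
  induction this with
  | refl => exact mem_image.2 ⟨a, ha, le_antisymm h1 h2⟩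
  | @tail y z hy hz ih =>
    rcases le_or_gt x (π y) with h | h
    · exact ih (by simpa using hz.2.1) h
    · have := hπ _ _ hz.1
      exact mem_image.2 ⟨z, by simpa using hz.2.2, by omega⟩

lemma proj_card_of_conn {S : Finset Cell} (hc : SetConnected (S : Set Cell)) (π : Cell → ℤ)
    (hπ : ∀ a b, Adj a b → π b ≤ π a + 1) (hne : S.Nonempty) :
    ∃ a b : ℤ, (∀ c ∈ S, a ≤ π c ∧ π c ≤ b) ∧ b + 1 - a ≤ (S.image π).card ∧ a ≤ b := by
  obtain ⟨u, hu, hu'⟩ := Finset.exists_min_image S π hne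
  obtain ⟨v, hv, hv'⟩ := Finset.exists_max_image S π hne
  refine ⟨π u, π v, fun c hc => ⟨hu' c hc, hv' c hc⟩, ?_, hu' v hv⟩
  have : Finset.Icc (π u) (π v) ⊆ S.image π := by
    intro x hx
    rw [Finset.mem_Icc] at hx
    exact interval_of_conn hc π hπ hu hv hx.1 hx.2
  have := Finset.card_le_card this
  rw [Int.card_Icc] at this
  omega

/-- A set with a gap in one projection has large perimeter. -/
lemma no_gap {E : Finset Cell} (π : Cell → ℤ) (hπ : ∀ a b, Adj a b → π b ≤ π a + 1)
    (h10 : 10 ≤ E.card) (hper : per E ≤ 14) {u v x : ℤ} (hu : u ∈ E.image π) (hv : v ∈ E.image π)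
    (h1 : u ≤ x) (h2 : x ≤ v) : x ∈ E.image π := by
  by_contra hx
  have hx' : ∀ c ∈ E, π c ≠ x := fun c hc h => hx (mem_image.2 ⟨c, hc, h⟩)
  have hs := per_split E (fun c => π c < x) (by
    intro c hc d hd hcd
    have e1 := hπ _ _ (adj_add (c := c) hd)
    have e2 := hπ (c + d) c (by
      have := adj_add (c := c + d) (neg_mem_dirs hd)
      rwa [add_neg_cancel_right] at this)
    have := hx' c hc
    have := hx' _ hcd
    omega)
  have g1 := per_ge (E.filter fun c => π c < x)
  have g2 := per_ge (E.filter fun c => ¬ π c < x)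
  have c1 := card_le_proj (E.filter fun c => π c < x)
  have c2 := card_le_proj (E.filter fun c => ¬ π c < x)
  have cs := Finset.card_filter_add_card_filter_not (s := E) (fun c => π c < x)
  have n1 : (E.filter fun c => π c < x).Nonempty := by
    obtain ⟨c, hc, rfl⟩ := mem_image.1 hu
    exact ⟨c, mem_filter.2 ⟨hc, lt_of_le_of_ne h1 (hx' c hc)⟩⟩
  have n2 : (E.filter fun c => ¬ π c < x).Nonempty := by
    obtain ⟨c, hc, rfl⟩ := mem_image.1 hv
    exact ⟨c, mem_filter.2 ⟨hc, by omega⟩⟩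
  have p1 := (n1.image Prod.fst).card_pos
  have p2 := (n1.image Prod.snd).card_pos
  have p3 := (n2.image Prod.fst).card_pos
  have p4 := (n2.image Prod.snd).card_pos
  generalize ((E.filter fun c => π c < x).image Prod.fst).card = a at *
  generalize ((E.filter fun c => π c < x).image Prod.snd).card = b at *
  generalize ((E.filter fun c => ¬ π c < x).image Prod.fst).card = a' at *
  generalize ((E.filter fun c => ¬ π c < x).image Prod.snd).card = b' at *
  have q : a + b + a' + b' ≤ 7 := by omega
  have q2 : 10 ≤ a * b + a' * b' := by omega
  have : a ≤ 4 := by omega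
  have : b ≤ 4 := by omega
  have : a' ≤ 4 := by omega
  clear * - q q2 p1 p2 p3 p4
  have : a ≤ 4 := by omega
  have : a' ≤ 4 := by omega
  interval_cases a <;> interval_cases a' <;> omega

lemma width_of_no_gap {E : Finset Cell} (π : Cell → ℤ) (hπ : ∀ a b, Adj a b → π b ≤ π a + 1)
    (h10 : 10 ≤ E.card) (hper : per E ≤ 14) {u v : Cell} (hu : u ∈ E) (hv : v ∈ E) :
    π v + 1 - π u ≤ (E.image π).card := by
  have : Finset.Icc (π u) (π v) ⊆ E.image π := by
    intro x hx
    rw [Finset.mem_Icc] at hx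
    exact no_gap π hπ h10 hper (mem_image_of_mem _ hu) (mem_image_of_mem _ hv) hx.1 hx.2
  have := Finset.card_le_card this
  rw [Int.card_Icc] at this
  omega

lemma adj_fst (a b : Cell) (h : Adj a b) : b.1 ≤ a.1 + 1 := by
  unfold Adj at h
  omega

lemma adj_snd (a b : Cell) (h : Adj a b) : b.2 ≤ a.2 + 1 := by
  unfold Adj at h
  omega

/-- Shapes of the box of the enclosed set. -/
def shapes : List (ℕ × ℕ) := [(3,4), (4,3), (2,5), (5,2)]

/-- Extension (left, right, down, up) of the box of the fence. -/
def exts : List (ℕ × ℕ × ℕ × ℕ) := [(1,0,0,0), (0,1,0,0), (0,0,1,0), (0,0,0,1)]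

lemma reduce (F E : Finset Cell) (hdisj : Disjoint F E)
    (hE : ∀ c ∈ E, ∀ d ∈ dirs, c + d ∈ F ∪ E) (hper : per F ≤ 38) (hF : F.card = 20)
    (hconn : SetConnected (F : Set Cell)) (h10 : 10 ≤ E.card) :
    ∃ X Y : ℤ, ∃ s ∈ shapes, ∃ x ∈ exts,
      (∀ e ∈ E, X ≤ e.1 ∧ e.1 < X + s.1 ∧ Y ≤ e.2 ∧ e.2 < Y + s.2) ∧
      (∀ c ∈ F, X - 1 - x.1 ≤ c.1 ∧ c.1 ≤ X + s.1 + x.2.1 ∧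
        Y - 1 - x.2.2.1 ≤ c.2 ∧ c.2 ≤ Y + s.2 + x.2.2.2) := by
  have hFne : F.Nonempty := Finset.card_pos.1 (by omega)
  have hEne : E.Nonempty := Finset.card_pos.1 (by omega)
  obtain ⟨x0, x1, hx, hW, hx01⟩ := proj_card_of_conn hconn Prod.fst adj_fst hFne
  obtain ⟨y0, y1, hy, hH, hy01⟩ := proj_card_of_conn hconn Prod.snd adj_snd hFne
  -- `E` is strictly inside the box of `F`
  have hbd : ∀ d ∈ dirs, ∀ e ∈ bd E d, e + d ∈ F := by
    intro d hd e he
    simp only [bd, mem_filter] at he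
    exact (mem_union.1 (hE e he.1 d hd)).resolve_right he.2
  have hin : ∀ e ∈ E, x0 < e.1 ∧ e.1 < x1 ∧ y0 < e.2 ∧ e.2 < y1 := by
    intro e he
    obtain ⟨a, ha, -, ha'⟩ := exists_bd (S := E) (d := (1,0)) (by decide) Prod.snd (by simp) he
    obtain ⟨b, hb, -, hb'⟩ := exists_bd (S := E) (d := (-1,0)) (by decide) Prod.snd (by simp) he
    obtain ⟨c, hc, -, hc'⟩ := exists_bd (S := E) (d := (0,1)) (by decide) Prod.fst (by simp) he
    obtain ⟨g, hg, -, hg'⟩ := exists_bd (S := E) (d := (0,-1)) (by decide) Prod.fst (by simp) he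
    have ha := hx _ (hbd _ (by decide) _ ha)
    have hb := hx _ (hbd _ (by decide) _ hb)
    have hc := hy _ (hbd _ (by decide) _ hc)
    have hg := hy _ (hbd _ (by decide) _ hg)
    simp only [Prod.fst_add, Prod.snd_add] at ha hb hc hg
    simp only [] at ha' hb' hc' hg'
    omega
  have hpu := per_union F E hdisj hE
  have hpR := per_ge (F ∪ E)
  have hpE := per_ge E
  have cR := card_le_proj (F ∪ E)
  have cE := card_le_proj E
  have cFE : (F ∪ E).card = F.card + E.card := Finset.card_union_of_disjoint hdisj
  have i1 : (F.image Prod.fst).card ≤ ((F ∪ E).image Prod.fst).card :=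
    Finset.card_le_card (Finset.image_subset_image Finset.subset_union_left)
  have i2 : (F.image Prod.snd).card ≤ ((F ∪ E).image Prod.snd).card :=
    Finset.card_le_card (Finset.image_subset_image Finset.subset_union_left)
  obtain ⟨u, hu, hu'⟩ := Finset.exists_min_image E Prod.fst hEne
  obtain ⟨v, hv, hv'⟩ := Finset.exists_max_image E Prod.fst hEne
  obtain ⟨u2, hu2, hu2'⟩ := Finset.exists_min_image E Prod.snd hEne
  obtain ⟨v2, hv2, hv2'⟩ := Finset.exists_max_image E Prod.snd hEne
  have wa : ((E.image Prod.fst).card : ℤ) ≤ v.1 + 1 - u.1 := by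
    have : E.image Prod.fst ⊆ Finset.Icc u.1 v.1 := by
      intro x hx
      obtain ⟨c, hc, rfl⟩ := mem_image.1 hx
      exact Finset.mem_Icc.2 ⟨hu' c hc, hv' c hc⟩
    have := Finset.card_le_card this
    rw [Int.card_Icc] at this
    have := hu' v hv
    omega
  have wb : ((E.image Prod.snd).card : ℤ) ≤ v2.2 + 1 - u2.2 := by
    have : E.image Prod.snd ⊆ Finset.Icc u2.2 v2.2 := by
      intro x hx
      obtain ⟨c, hc, rfl⟩ := mem_image.1 hx
      exact Finset.mem_Icc.2 ⟨hu2' c hc, hv2' c hc⟩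
    have := Finset.card_le_card this
    rw [Int.card_Icc] at this
    have := hu2' v2 hv2
    omega
  have w1 := fun h => width_of_no_gap (E := E) Prod.fst adj_fst h10 h hu hv
  have w2 := fun h => width_of_no_gap (E := E) Prod.snd adj_snd h10 h hu2 hv2
  have b1 := hin u hu
  have b2 := hin v hv
  have b3 := hin u2 hu2
  have b4 := hin v2 hv2
  generalize ((F ∪ E).image Prod.fst).card = aR at *
  generalize ((F ∪ E).image Prod.snd).card = bR at *
  generalize (E.image Prod.fst).card = aE at *
  generalize (E.image Prod.snd).card = bE at *
  have s1 : 11 ≤ aR + bR := by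
    by_contra h
    have : 30 ≤ aR * bR := by omega
    have : aR ≤ 10 := by omega
    have hb : bR ≤ 10 - aR := by omega
    interval_cases aR <;> omega
  have t1 : 10 ≤ aE * bE := by omega
  have s2 : 7 ≤ aE + bE := by
    by_contra h
    have : aE ≤ 6 := by omega
    interval_cases aE <;> omega
  have s3 : v.1 + 1 - u.1 + (v2.2 + 1 - u2.2) ≤ 7 := by
    by_contra h
    have : per E ≤ 14 := by omega
    have := w1 ‹_›
    have := w2 ‹_›
    omega
  have aE7 : aE ≤ 7 := by omega
  have hab : aE + bE = 7 := by omega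
  have hsh : (aE, bE) ∈ shapes := by
    have : bE = 7 - aE := by omega
    subst this
    clear * - aE7 t1
    interval_cases aE <;> first | omega | decide
  refine ⟨u.1, u2.2, (aE, bE), hsh, ?_⟩
  have hEb : ∀ e ∈ E, u.1 ≤ e.1 ∧ e.1 < u.1 + (aE : ℤ) ∧ u2.2 ≤ e.2 ∧ e.2 < u2.2 + (bE : ℤ) := by
    intro e he
    have := hu' e he
    have := hv' e he
    have := hu2' e he
    have := hv2' e he
    omega
  have fin : ∀ x ∈ exts, (u.1 - 1 - x.1 ≤ x0 ∧ x1 ≤ u.1 + aE + x.2.1 ∧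
      u2.2 - 1 - x.2.2.1 ≤ y0 ∧ y1 ≤ u2.2 + bE + x.2.2.2) → ∃ x ∈ exts,
      (∀ e ∈ E, u.1 ≤ e.1 ∧ e.1 < u.1 + (aE : ℤ) ∧ u2.2 ≤ e.2 ∧ e.2 < u2.2 + (bE : ℤ)) ∧
      (∀ c ∈ F, u.1 - 1 - x.1 ≤ c.1 ∧ c.1 ≤ u.1 + aE + x.2.1 ∧
        u2.2 - 1 - x.2.2.1 ≤ c.2 ∧ c.2 ≤ u2.2 + bE + x.2.2.2) := by
    intro x hxe h
    refine ⟨x, hxe, hEb, fun c hc => ?_⟩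
    have := hx c hc
    have := hy c hc
    omega
  have e0 : x1 + 1 - x0 + (y1 + 1 - y0) ≤ 12 := by omega
  have e1 : x0 ≤ u.1 - 1 := by omega
  have e2 : u.1 + aE ≤ x1 := by omega
  have e3 : y0 ≤ u2.2 - 1 := by omega
  have e4 : u2.2 + bE ≤ y1 := by omega
  by_cases k1 : x0 = u.1 - 1
  · by_cases k2 : x1 = u.1 + aE
    · by_cases k3 : y0 = u2.2 - 1
      · exact fin (0,0,0,1) (by decide) (by simp only []; push_cast; omega)
      · exact fin (0,0,1,0) (by decide) (by simp only []; push_cast; omega)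
    · exact fin (0,1,0,0) (by decide) (by simp only []; push_cast; omega)
  · exact fin (1,0,0,0) (by decide) (by simp only []; push_cast; omega)

end TFence

namespace TFence

/-! ### The search. Cells of a window are numbered `x + 16 * y`, sets of cells are bit masks. -/

/-- Masks of the placements of the tetromino I through bit 51, grouped by a common bit. -/
def G0 : List (ℕ × List ℕ) := [
  (nat_lit 34359738368, [nat_lit 2251834173947912, nat_lit 147576204423850360832, nat_lit 9671554133121457247485952]),
  (nat_lit 1125899906842624, [nat_lit 4222124650659840, nat_lit 8444249301319680, nat_lit 16888498602639360]),
  (nat_lit 4503599627370496, [nat_lit 33776997205278720]),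
  (nat_lit 147573952589676412928, [nat_lit 633834971668247822171239350272])]

/-- Masks of the placements of the tetromino L through bit 51, grouped by a common bit. -/
def G1 : List (ℕ × List ℕ) := [
  (nat_lit 34359738368, [nat_lit 2251834174210048, nat_lit 2251834174996480, nat_lit 2251859943227392, nat_lit 2252040331853824, nat_lit 147576204441029705728, nat_lit 147576204492569313280, nat_lit 221363180718688043008, nat_lit 442724109603202662400]),
  (nat_lit 1125899906842624, [nat_lit 3377716900659200, nat_lit 3377734080790528, nat_lit 3940658263883776, nat_lit 3940684033687552, nat_lit 7881316527767552, nat_lit 7881368067375104, nat_lit 36897428797093052416, nat_lit 73794857594186104832, nat_lit 147577893239350362112, nat_lit 295155786478700724224, nat_lit 4835777068812511257559040, nat_lit 9671554134247322794590208]),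
  (nat_lit 4503599627370496, [nat_lit 6755433801318400, nat_lit 6755468161581056, nat_lit 15762633055535104, nat_lit 15762736134750208, nat_lit 147589715188372209664, nat_lit 590311572957401448448, nat_lit 9671554137625022515118080, nat_lit 19343108268494645589180416]),
  (nat_lit 147573952589676412928, [nat_lit 258256668831747407872, nat_lit 1033019919927548575744, nat_lit 14507257411579939586572288, nat_lit 29014367246955489683046400])]

/-- Masks of the placements of the tetromino N through bit 51, grouped by a common bit. -/
def G2 : List (ℕ × List ℕ) := [
  (nat_lit 34359738368, [nat_lit 2251851353554944, nat_lit 2251902893948928]),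
  (nat_lit 1125899906842624, [nat_lit 3377725490331648, nat_lit 3377802799742976, nat_lit 73790354028918472704, nat_lit 110683842141977837568, nat_lit 147577330306576809984, nat_lit 442725235468749766656]),
  (nat_lit 4503599627370496, [nat_lit 6755450980663296, nat_lit 6755605599485952, nat_lit 147580708057836945408, nat_lit 221367684283955675136, nat_lit 295154660613153619968, nat_lit 885450470937499533312]),
  (nat_lit 147573952589676412928, [nat_lit 4835924641639201027129344, nat_lit 19343255837943635638222848])]

/-- Masks of the placements of the tetromino O through bit 51, grouped by a common bit. -/
def G3 : List (ℕ × List ℕ) := [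
  (nat_lit 1125899906842624, [nat_lit 3377751260135424, nat_lit 221364306584235147264]),
  (nat_lit 4503599627370496, [nat_lit 6755502520270848, nat_lit 442728613168470294528])]

/-- Masks of the placements of the tetromino T through bit 51, grouped by a common bit. -/
def G4 : List (ℕ × List ℕ) := [
  (nat_lit 34359738368, [nat_lit 2251851353817088, nat_lit 2251902893424640, nat_lit 2251920072769536]),
  (nat_lit 1125899906842624, [nat_lit 3940666853818368, nat_lit 7881333707636736, nat_lit 73790354011738603520, nat_lit 73790916944512155648, nat_lit 147577330323756679168, nat_lit 147581833889024311296]),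
  (nat_lit 4503599627370496, [nat_lit 15762667415273472, nat_lit 147580708023477207040, nat_lit 295154660647513358336, nat_lit 295163667778048622592]),
  (nat_lit 147573952589676412928, [nat_lit 516511085863681130496, nat_lit 9671627920097717725954048, nat_lit 9671849281026602240573440])]
/-- The mask of neighbours of the mask. -/
def nbm (m : ℕ) : ℕ :=
  Nat.lor (Nat.lor (Nat.shiftLeft m 1) (Nat.shiftRight m 1))
    (Nat.lor (Nat.shiftLeft m 16) (Nat.shiftRight m 16))

/-- Two masks are adjacent. -/
def hit (a b : ℕ) : Bool := !(Nat.beq (Nat.land (nbm a) b) 0)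

/-- Some piece is missing, or every piece has two neighbours. -/
def leafOk (s : List ℕ) : Bool :=
  (List.range 5).any (fun i => Nat.beq (s.getD i 0) 0) ||
  (List.range 5).all (fun i => (List.range 5).any fun j => (List.range 5).any fun k =>
    !(Nat.beq j i) && !(Nat.beq k i) && !(Nat.beq j k) &&
      hit (s.getD i 0) (s.getD j 0) && hit (s.getD i 0) (s.getD k 0))

/-- Try all the masks of a list. -/
def tryB (B : List ℕ) (us : ℕ) (k : ℕ → Bool) (r : Bool) : Bool :=
  List.rec r (fun b _ r => Bool.rec r (Bool.rec r true (k b)) (Nat.beq (Nat.land b us) 0)) B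

/-- Try all the masks of a piece which is not yet used. -/
def tryP (s : ℕ) (G : List (ℕ × List ℕ)) (us : ℕ) (k : ℕ → Bool) (r : Bool) : Bool :=
  Bool.rec r (List.rec r (fun g _ r =>
    Bool.rec r (tryB g.2 us k r) (Nat.beq (Nat.land g.1 us) 0)) G) (Nat.beq s 0)

/-- One step of the search: the cell `c + 51` has to be covered. -/
def step (c : ℕ) (ih : ℕ → ℕ → ℕ → ℕ → ℕ → ℕ → Bool) (used s0 s1 s2 s3 s4 us : ℕ) : Bool :=
  tryP s3 G3 us
    (fun m => ih (Nat.lor used (Nat.shiftLeft m c)) s0 s1 s2 (Nat.shiftLeft m c) s4) <|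
  tryP s2 G2 us
    (fun m => ih (Nat.lor used (Nat.shiftLeft m c)) s0 s1 (Nat.shiftLeft m c) s3 s4) <|
  tryP s4 G4 us
    (fun m => ih (Nat.lor used (Nat.shiftLeft m c)) s0 s1 s2 s3 (Nat.shiftLeft m c)) <|
  tryP s1 G1 us
    (fun m => ih (Nat.lor used (Nat.shiftLeft m c)) s0 (Nat.shiftLeft m c) s2 s3 s4) <|
  tryP s0 G0 us
    (fun m => ih (Nat.lor used (Nat.shiftLeft m c)) (Nat.shiftLeft m c) s1 s2 s3 s4) false

/-- Cover the cells of the list by pieces not meeting `used`. -/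
def srch (l : List ℕ) : ℕ → ℕ → ℕ → ℕ → ℕ → ℕ → Bool :=
  List.rec (fun _ s0 s1 s2 s3 s4 => leafOk [s0, s1, s2, s3, s4])
    (fun c _ ih used s0 s1 s2 s3 s4 =>
      Bool.rec (step c ih used s0 s1 s2 s3 s4 (Nat.shiftRight used c))
        (ih used s0 s1 s2 s3 s4) (Nat.testBit used (Nat.add c 51))) l

/-- Cells of a rectangle. -/
def rect (x0 y0 w h : ℕ) : List ℕ :=
  (List.range h).flatMap fun y => (List.range w).map fun x => (x0 + x) + 16 * (y0 + y)

/-- Mask of a list of cells. -/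
def msk (l : List ℕ) : ℕ := l.foldr (fun c m => Nat.lor (2 ^ c) m) 0

/-- Masks of subsets with at most two elements. -/
def smalls (l : List ℕ) : List ℕ :=
  0 :: l.flatMap fun c => (l.filter fun d => Nat.ble c d).map fun d => Nat.lor (2 ^ c) (2 ^ d)

/-- Search with enclosed set `e` and box `b`. -/
def srchE (cells : List ℕ) (e b : ℕ) : Bool :=
  srch (cells.filter fun c => Nat.testBit (nbm e) (Nat.add c 51) && !Nat.testBit e (Nat.add c 51))
    (Nat.lor e (Nat.xor (2 ^ 256 - 1) b)) 0 0 0 0 0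

/-- Box of the fence. -/
def boxM (s : ℕ × ℕ) (x : ℕ × ℕ × ℕ × ℕ) : ℕ :=
  msk (rect (5 - x.1) (5 - x.2.2.1) (s.1 + 2 + x.1 + x.2.1) (s.2 + 2 + x.2.2.1 + x.2.2.2))

/-- Search over all boxes and all enclosed sets. -/
def srchAll (s : ℕ × ℕ) (cells : List ℕ) (miss : List ℕ) : Bool :=
  miss.any fun d => exts.any fun x =>
    srchE cells (Nat.xor (msk (rect 6 6 s.1 s.2)) d) (boxM s x)

def cells34 : List ℕ := [34, 35, 36, 37, 38, 50, 51, 52, 53, 54, 66, 67, 68, 69, 70, 82, 83, 84, 85,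
  86, 98, 99, 100, 101, 102, 114, 115, 116, 117, 118]
def cells43 : List ℕ := [34, 50, 66, 82, 98, 35, 51, 67, 83, 99, 36, 52, 68, 84, 100, 37, 53, 69, 85,
  101, 38, 54, 70, 86, 102, 39, 55, 71, 87, 103]
def cells25 : List ℕ := (rect 5 5 4 7).map (· - 51)
def cells52 : List ℕ := (rect 5 5 7 4).map (· - 51)
lemma srch25 : srchAll (2,5) cells25 [0] = false := by decide +kernel
lemma srch52 : srchAll (5,2) cells52 [0] = false := by decide +kernel
lemma srch34 : srchAll (3,4) cells34 (smalls (rect 6 6 3 4)) = false := by decide +kernel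
lemma srch43 : srchAll (4,3) cells43 (smalls (rect 6 6 4 3)) = false := by decide +kernel

end TFence

namespace TFence

lemma tryB_of_r {B : List ℕ} {us : ℕ} {k : ℕ → Bool} {r : Bool} (h : r = true) :
    tryB B us k r = true := by
  subst h
  induction B with
  | nil => rfl
  | cons b B ih =>
    change (Bool.rec (tryB B us k true) (Bool.rec (tryB B us k true) true (k b))
      (Nat.beq (Nat.land b us) 0) : Bool) = true
    rw [ih]
    cases Nat.beq (Nat.land b us) 0 <;> cases k b <;> rfl

lemma tryB_mem {B : List ℕ} {us : ℕ} {k : ℕ → Bool} {r : Bool} {b : ℕ} (hb : b ∈ B)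
    (h0 : b &&& us = 0) (hk : k b = true) : tryB B us k r = true := by
  induction B with
  | nil => simp at hb
  | cons a B ih =>
    change (Bool.rec (tryB B us k r) (Bool.rec (tryB B us k r) true (k a))
      (Nat.beq (Nat.land a us) 0) : Bool) = true
    rcases List.mem_cons.1 hb with rfl | hb
    · have : Nat.land b us = 0 := h0
      rw [this, hk]
      rfl
    · rw [ih hb]
      cases Nat.beq (Nat.land a us) 0 <;> cases k a <;> rfl

lemma tryP_of_r {s : ℕ} {G : List (ℕ × List ℕ)} {us : ℕ} {k : ℕ → Bool} {r : Bool}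
    (h : r = true) : tryP s G us k r = true := by
  unfold tryP
  have : (List.rec r (fun g _ r =>
    Bool.rec r (tryB g.2 us k r) (Nat.beq (Nat.land g.1 us) 0)) G : Bool) = true := by
    induction G with
    | nil => exact h
    | cons g G ih =>
      simp only
      rw [ih, tryB_of_r rfl]
      cases Nat.beq (Nat.land g.1 us) 0 <;> rfl
  rw [this, h]
  cases Nat.beq s 0 <;> rfl

lemma tryP_mem {s : ℕ} {G : List (ℕ × List ℕ)} {us : ℕ} {k : ℕ → Bool} {r : Bool}
    (hs : s = 0) {g : ℕ × List ℕ} (hg : g ∈ G) {b : ℕ} (hb : b ∈ g.2) (h0 : b &&& us = 0)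
    (h1 : g.1 &&& us = 0) (hk : k b = true) : tryP s G us k r = true := by
  subst hs
  unfold tryP
  change (List.rec r (fun g _ r =>
    Bool.rec r (tryB g.2 us k r) (Nat.beq (Nat.land g.1 us) 0)) G : Bool) = true
  induction G with
  | nil => simp at hg
  | cons a G ih =>
    simp only
    rcases List.mem_cons.1 hg with rfl | hg
    · have : Nat.land g.1 us = 0 := h1
      rw [this, tryB_mem hb h0 hk]
      rfl
    · rw [ih hg, tryB_of_r rfl]
      cases Nat.beq (Nat.land a.1 us) 0 <;> rfl

/-- The groups of masks of the five pieces. -/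
def GG : Fin 5 → List (ℕ × List ℕ) := ![G0, G1, G2, G3, G4]

lemma GG_sub : ∀ i, ∀ g ∈ GG i, ∀ b ∈ g.2, g.1 &&& b = g.1 := by decide +kernel

lemma step_mem {c : ℕ} {ih : ℕ → ℕ → ℕ → ℕ → ℕ → ℕ → Bool} {used us : ℕ} {σ : Fin 5 → ℕ}
    (i : Fin 5) (hs : σ i = 0) {g : ℕ × List ℕ} (hg : g ∈ GG i) {b : ℕ} (hb : b ∈ g.2)
    (h0 : b &&& us = 0) (τ : Fin 5 → ℕ) (hτ : τ = Function.update σ i (b <<< c))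
    (hk : ih (used ||| b <<< c) (τ 0) (τ 1) (τ 2) (τ 3) (τ 4) = true) :
    step c ih used (σ 0) (σ 1) (σ 2) (σ 3) (σ 4) us = true := by
  have h1 : g.1 &&& us = 0 := by
    rw [← GG_sub i g hg b hb, Nat.land_assoc, h0, Nat.and_zero]
  subst hτ
  unfold step
  fin_cases i
  · exact tryP_of_r <| tryP_of_r <| tryP_of_r <| tryP_of_r <| tryP_mem hs hg hb h0 h1 hk
  · exact tryP_of_r <| tryP_of_r <| tryP_of_r <| tryP_mem hs hg hb h0 h1 hk
  · exact tryP_of_r <| tryP_mem hs hg hb h0 h1 hk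
  · exact tryP_mem hs hg hb h0 h1 hk
  · exact tryP_of_r <| tryP_of_r <| tryP_mem hs hg hb h0 h1 hk

lemma srch_sound (m : Fin 5 → ℕ) (hdisj : ∀ i j, i ≠ j → m i &&& m j = 0)
    (hleaf : leafOk [m 0, m 1, m 2, m 3, m 4] = true) (l : List ℕ)
    (hpl : ∀ i, ∀ c ∈ l, (m i).testBit (c + 51) = true →
      ∃ g ∈ GG i, ∃ b ∈ g.2, m i = b <<< c)
    (hcov : ∀ c ∈ l, ∃ i, (m i).testBit (c + 51) = true) (used : ℕ) (σ : Fin 5 → ℕ)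
    (hσ : ∀ i, (σ i = 0 ∧ m i &&& used = 0) ∨
      (σ i = m i ∧ ∀ c, (m i).testBit c = true → used.testBit c = true)) :
    srch l used (σ 0) (σ 1) (σ 2) (σ 3) (σ 4) = true := by
  induction l generalizing used σ with
  | nil =>
    change leafOk [σ 0, σ 1, σ 2, σ 3, σ 4] = true
    by_cases h : ∃ i, σ i = 0
    · obtain ⟨i, hi⟩ := h
      unfold leafOk
      rw [Bool.or_eq_true]
      left
      rw [List.any_eq_true]
      refine ⟨i, by simp, ?_⟩
      fin_cases i <;> simpa using hi
    · push Not at h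
      have : σ = m := by
        funext i
        rcases hσ i with h1 | h1
        · exact absurd h1.1 (h i)
        · exact h1.1
      rw [this]
      exact hleaf
  | cons c l ih =>
    have ih' := ih (fun i d hd => hpl i d (List.mem_cons_of_mem _ hd))
      (fun d hd => hcov d (List.mem_cons_of_mem _ hd))
    change (Bool.rec (step c (srch l) used (σ 0) (σ 1) (σ 2) (σ 3) (σ 4) (used >>> c))
      (srch l used (σ 0) (σ 1) (σ 2) (σ 3) (σ 4)) (Nat.testBit used (c + 51)) : Bool) = true
    cases hu : Nat.testBit used (c + 51) with
    | true => exact ih' used σ hσ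
    | false =>
      change step c (srch l) used (σ 0) (σ 1) (σ 2) (σ 3) (σ 4) (used >>> c) = true
      obtain ⟨i, hi⟩ := hcov c (List.mem_cons_self)
      obtain ⟨g, hg, b, hb, hm⟩ := hpl i c (List.mem_cons_self) hi
      rcases hσ i with ⟨hs, h0⟩ | ⟨-, h1⟩
      swap
      · rw [h1 _ hi] at hu
        exact absurd hu (by simp)
      have hb0 : b &&& (used >>> c) = 0 := by
        apply Nat.eq_of_testBit_eq
        intro k
        have := congrArg (fun n => Nat.testBit n (k + c)) h0
        rw [hm] at this
        simp only [Nat.testBit_and, Nat.testBit_shiftLeft, Nat.zero_testBit,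
          Nat.testBit_shiftRight] at this ⊢
        simpa [Nat.add_comm] using this
      refine step_mem i hs hg hb hb0 _ rfl (ih' _ _ ?_)
      intro j
      by_cases hj : j = i
      · subst hj
        right
        refine ⟨by simp [hm], fun d hd => ?_⟩
        rw [hm] at hd
        rw [Nat.testBit_or, hd, Bool.or_true]
      · rw [Function.update_of_ne hj, ← hm]
        rcases hσ j with ⟨h1, h2⟩ | ⟨h1, h2⟩
        · left
          refine ⟨h1, ?_⟩
          rw [Nat.and_or_distrib_left, h2, hdisj j i hj]
          rfl
        · right
          refine ⟨h1, fun d hd => ?_⟩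
          rw [Nat.testBit_or, h2 d hd, Bool.true_or]

end TFence

namespace TFence
open Finset

/-- Number of a cell in the window at `(X, Y)`. -/
def idx (X Y : ℤ) (c : Cell) : ℕ := ((c.1 - X + 6) + 16 * (c.2 - Y + 6)).toNat

/-- The cell is inside the window. -/
def Win (X Y : ℤ) (c : Cell) : Prop :=
  1 ≤ c.1 - X + 6 ∧ c.1 - X + 6 < 15 ∧ 1 ≤ c.2 - Y + 6 ∧ c.2 - Y + 6 < 15

lemma idx_cast {X Y : ℤ} {c : Cell} (h : Win X Y c) :
    (idx X Y c : ℤ) = (c.1 - X + 6) + 16 * (c.2 - Y + 6) := by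
  obtain ⟨h1, h2, h3, h4⟩ := h
  unfold idx
  omega

lemma idx_inj {X Y : ℤ} {c d : Cell} (hc : Win X Y c) (hd : Win X Y d)
    (h : idx X Y c = idx X Y d) : c = d := by
  have h1 := idx_cast hc
  have h2 := idx_cast hd
  rw [h] at h1
  obtain ⟨a1, a2, a3, a4⟩ := hc
  obtain ⟨b1, b2, b3, b4⟩ := hd
  ext <;> omega

lemma testBit_msk (l : List ℕ) (k : ℕ) : (msk l).testBit k = true ↔ k ∈ l := by
  induction l with
  | nil => simp [msk]
  | cons a l ih =>
    change ((2 ^ a) ||| msk l).testBit k = true ↔ _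
    rw [Nat.testBit_or, Bool.or_eq_true, ih, Nat.testBit_two_pow, List.mem_cons]
    simp [eq_comm]

/-- The mask of a set of cells. -/
noncomputable def mask (X Y : ℤ) (S : Finset Cell) : ℕ := msk (S.toList.map (idx X Y))

lemma testBit_mask {X Y : ℤ} {S : Finset Cell} {k : ℕ} :
    (mask X Y S).testBit k = true ↔ ∃ c ∈ S, idx X Y c = k := by
  rw [mask, testBit_msk]
  simp

lemma ext_bits {a b : ℕ} (h : ∀ k, a.testBit k = true ↔ b.testBit k = true) : a = b :=
  Nat.eq_of_testBit_eq fun k => Bool.eq_iff_iff.2 (h k)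

lemma and_zero_bits {a b : ℕ} (h : ∀ k, a.testBit k = true → b.testBit k = true → False) :
    a &&& b = 0 := by
  refine ext_bits fun k => ?_
  rw [Nat.testBit_and, Bool.and_eq_true]
  simpa using h k

lemma idx_add {X Y : ℤ} {c d : Cell} (hc : Win X Y c) (hd : d ∈ dirs) :
    (d = (1, 0) ∧ idx X Y (c + d) = idx X Y c + 1) ∨
    (d = (-1, 0) ∧ idx X Y (c + d) + 1 = idx X Y c) ∨
    (d = (0, 1) ∧ idx X Y (c + d) = idx X Y c + 16) ∨
    (d = (0, -1) ∧ idx X Y (c + d) + 16 = idx X Y c) := by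
  obtain ⟨a1, a2, a3, a4⟩ := hc
  simp only [dirs, mem_insert, mem_singleton] at hd
  rcases hd with rfl | rfl | rfl | rfl
  · left
    refine ⟨rfl, ?_⟩
    simp only [idx, Prod.fst_add, Prod.snd_add]; omega
  · right; left
    refine ⟨rfl, ?_⟩
    simp only [idx, Prod.fst_add, Prod.snd_add]; omega
  · right; right; left
    refine ⟨rfl, ?_⟩
    simp only [idx, Prod.fst_add, Prod.snd_add]; omega
  · right; right; right
    refine ⟨rfl, ?_⟩
    simp only [idx, Prod.fst_add, Prod.snd_add]; omega

lemma testBit_nbm (m k : ℕ) : (nbm m).testBit k = true ↔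
    (1 ≤ k ∧ m.testBit (k - 1) = true) ∨ m.testBit (k + 1) = true ∨
    (16 ≤ k ∧ m.testBit (k - 16) = true) ∨ m.testBit (k + 16) = true := by
  change (((m <<< 1) ||| (m >>> 1)) ||| ((m <<< 16) ||| (m >>> 16))).testBit k = true ↔ _
  simp only [Nat.testBit_or, Bool.or_eq_true, Nat.testBit_shiftLeft, Nat.testBit_shiftRight,
    Bool.and_eq_true, decide_eq_true_eq, or_assoc, ge_iff_le, Nat.add_comm 1 k, Nat.add_comm 16 k]

lemma nbm_mask {X Y : ℤ} {S : Finset Cell} (hS : ∀ c ∈ S, Win X Y c) {k : ℕ} :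
    (nbm (mask X Y S)).testBit k = true ↔ ∃ c ∈ S, ∃ d ∈ dirs, idx X Y (c + d) = k := by
  rw [testBit_nbm]
  simp only [testBit_mask]
  constructor
  · rintro (⟨h, c, hc, h1⟩ | ⟨c, hc, h1⟩ | ⟨h, c, hc, h1⟩ | ⟨c, hc, h1⟩)
    · refine ⟨c, hc, (1, 0), by decide, ?_⟩
      rcases idx_add (hS c hc) (d := (1, 0)) (by decide) with h | h | h | h <;> simp at h
      omega
    · refine ⟨c, hc, (-1, 0), by decide, ?_⟩
      rcases idx_add (hS c hc) (d := (-1, 0)) (by decide) with h | h | h | h <;> simp at h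
      omega
    · refine ⟨c, hc, (0, 1), by decide, ?_⟩
      rcases idx_add (hS c hc) (d := (0, 1)) (by decide) with h | h | h | h <;> simp at h
      omega
    · refine ⟨c, hc, (0, -1), by decide, ?_⟩
      rcases idx_add (hS c hc) (d := (0, -1)) (by decide) with h | h | h | h <;> simp at h
      omega
  · rintro ⟨c, hc, d, hd, rfl⟩
    rcases idx_add (hS c hc) hd with ⟨-, h⟩ | ⟨-, h⟩ | ⟨-, h⟩ | ⟨-, h⟩
    · exact Or.inl ⟨by omega, c, hc, by omega⟩
    · exact Or.inr (Or.inl ⟨c, hc, by omega⟩)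
    · exact Or.inr (Or.inr (Or.inl ⟨by omega, c, hc, by omega⟩))
    · exact Or.inr (Or.inr (Or.inr ⟨c, hc, by omega⟩))

/-- The tetrominoes as lists. -/
def tetL : Fin 5 → List Cell :=
  ![[(0,0), (0,1), (0,2), (0,3)],
    [(0,0), (1,0), (0,1), (0,2)],
    [(0,0), (1,0), (1,1), (2,1)],
    [(0,0), (1,0), (0,1), (1,1)],
    [(0,0), (1,0), (2,0), (1,1)]]

lemma mem_tetL (i : Fin 5) (c : Cell) : c ∈ tetC i ↔ c ∈ tetL i := by
  fin_cases i <;> simp [tetC, tetL]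

lemma base_mem : ∀ f ∈ symms, ∀ i, ∀ p ∈ tetL i,
    (∀ q ∈ tetL i, 0 ≤ 51 + (f q - f p).1 + 16 * (f q - f p).2) ∧ ∃ g ∈ GG i,
      msk ((tetL i).map fun q => (51 + (f q - f p).1 + 16 * (f q - f p).2).toNat) ∈ g.2 := by
  decide +kernel

lemma piece_base {X Y : ℤ} {i : Fin 5} {f : Cell → Cell} (hf : f ∈ symms) {t : Cell}
    {P : Finset Cell} (hP : ∀ c, c ∈ P ↔ ∃ q ∈ tetC i, f q + t = c) (hW : ∀ c ∈ P, Win X Y c)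
    {c : ℕ} (hc : (mask X Y P).testBit (c + 51) = true) :
    ∃ g ∈ GG i, ∃ b ∈ g.2, mask X Y P = b <<< c := by
  obtain ⟨p', hp', hpc⟩ := testBit_mask.1 hc
  obtain ⟨p, hp, rfl⟩ := (hP _).1 hp'
  obtain ⟨h0, g, hg, hb⟩ := base_mem f hf i p ((mem_tetL i p).1 hp)
  refine ⟨g, hg, _, hb, ?_⟩
  have key : ∀ q ∈ tetC i, idx X Y (f q + t) =
      (51 + (f q - f p).1 + 16 * (f q - f p).2).toNat + c := by
    intro q hq
    have h1 := idx_cast (hW _ ((hP _).2 ⟨q, hq, rfl⟩))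
    have h2 := idx_cast (hW _ hp')
    have h3 := h0 q ((mem_tetL i q).1 hq)
    rw [hpc] at h2
    simp only [Prod.fst_add, Prod.snd_add, Prod.fst_sub, Prod.snd_sub] at *
    omega
  refine ext_bits fun k => ?_
  rw [testBit_mask, Nat.testBit_shiftLeft, Bool.and_eq_true, testBit_msk, decide_eq_true_eq,
    List.mem_map]
  constructor
  · rintro ⟨a, ha, rfl⟩
    obtain ⟨q, hq, rfl⟩ := (hP _).1 ha
    rw [key q hq]
    exact ⟨by omega, q, (mem_tetL i q).1 hq, by omega⟩
  · rintro ⟨hk, q, hq, h⟩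
    have hq' := (mem_tetL i q).2 hq
    exact ⟨_, (hP _).2 ⟨q, hq', rfl⟩, by rw [key q hq']; omega⟩

lemma mem_rect {x0 y0 w h k : ℕ} :
    k ∈ rect x0 y0 w h ↔ ∃ y < h, ∃ x < w, (x0 + x) + 16 * (y0 + y) = k := by
  simp [rect]

lemma mem_smalls {X Y : ℤ} {D : Finset Cell} (hD : D.card ≤ 2) {l : List ℕ}
    (hl : ∀ c ∈ D, idx X Y c ∈ l) : mask X Y D ∈ smalls l := by
  have two : ∀ a b : Cell, D = {a, b} → mask X Y D = 2 ^ idx X Y a ||| 2 ^ idx X Y b := by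
    rintro a b rfl
    refine ext_bits fun k => ?_
    rw [testBit_mask, Nat.testBit_or, Bool.or_eq_true, Nat.testBit_two_pow, Nat.testBit_two_pow]
    simp
  have two' : ∀ a b : Cell, D = {a, b} → mask X Y D ∈ smalls l := by
    intro a b hab
    rw [two a b hab]
    have ha := hl a (by simp [hab])
    have hb := hl b (by simp [hab])
    refine List.mem_cons_of_mem _ ?_
    rw [List.mem_flatMap]
    rcases le_total (idx X Y a) (idx X Y b) with h | h
    · exact ⟨_, ha, List.mem_map.2 ⟨_, List.mem_filter.2 ⟨hb, Nat.ble_eq_true_of_le h⟩, rfl⟩⟩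
    · exact ⟨_, hb, List.mem_map.2 ⟨_, List.mem_filter.2 ⟨ha, Nat.ble_eq_true_of_le h⟩, Nat.lor_comm _ _⟩⟩
  have h3 : D.card = 0 ∨ D.card = 1 ∨ D.card = 2 := by omega
  rcases h3 with h | h | h
  · rw [Finset.card_eq_zero.1 h]
    have : mask X Y ∅ = 0 := by simp [mask, msk]
    rw [this]
    exact List.mem_cons_self
  · obtain ⟨a, ha⟩ := Finset.card_eq_one.1 h
    exact two' a a (by simp [ha])
  · obtain ⟨a, b, -, hab⟩ := Finset.card_eq_two.1 h
    exact two' a b hab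

lemma exts_le : ∀ x ∈ exts, x.1 ≤ 1 ∧ x.2.1 ≤ 1 ∧ x.2.2.1 ≤ 1 ∧ x.2.2.2 ≤ 1 := by decide

lemma instantiate (X Y : ℤ) (s : ℕ × ℕ) (hs1 : s.1 ≤ 5) (hs2 : s.2 ≤ 5)
    (x : ℕ × ℕ × ℕ × ℕ) (hx : x ∈ exts) (p : Fin 5 → Finset Cell) (E : Finset Cell)
    (hpl : ∀ i, ∃ f ∈ symms, ∃ t : Cell, ∀ c, c ∈ p i ↔ ∃ q ∈ tetC i, f q + t = c)
    (hd : ∀ i j, i ≠ j → Disjoint (p i) (p j)) (hdE : ∀ i, Disjoint (p i) E)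
    (hadj : ∀ i, ∃ j k, j ≠ i ∧ k ≠ i ∧ j ≠ k ∧ (apairs (p i) (p j)).Nonempty ∧
      (apairs (p i) (p k)).Nonempty)
    (hN : ∀ c ∈ E, ∀ d ∈ dirs, c + d ∉ E → ∃ i, c + d ∈ p i)
    (hE : ∀ e ∈ E, X ≤ e.1 ∧ e.1 < X + s.1 ∧ Y ≤ e.2 ∧ e.2 < Y + s.2)
    (hF : ∀ i, ∀ c ∈ p i, X - 1 - x.1 ≤ c.1 ∧ c.1 ≤ X + s.1 + x.2.1 ∧
        Y - 1 - x.2.2.1 ≤ c.2 ∧ c.2 ≤ Y + s.2 + x.2.2.2)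
    (cells miss : List ℕ)
    (hmiss : ∀ D : Finset Cell, D.card + E.card = s.1 * s.2 →
      (∀ c ∈ D, idx X Y c ∈ rect 6 6 s.1 s.2) → mask X Y D ∈ miss) :
    srchAll s cells miss = true := by
  obtain ⟨hx1, hx2, hx3, hx4⟩ := exts_le x hx
  have WE : ∀ e ∈ E, Win X Y e := by
    intro e he
    have := hE e he
    unfold Win
    omega
  have WF : ∀ i, ∀ c ∈ p i, Win X Y c := by
    intro i c hc
    have := hF i c hc
    unfold Win
    omega
  let I : Finset Cell := (Finset.Ico X (X + s.1)) ×ˢ (Finset.Ico Y (Y + s.2))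
  have hI : ∀ c, c ∈ I ↔ X ≤ c.1 ∧ c.1 < X + s.1 ∧ Y ≤ c.2 ∧ c.2 < Y + s.2 := by
    intro c
    simp [I, and_assoc]
  have hEI : E ⊆ I := fun e he => (hI e).2 (hE e he)
  have hIc : I.card = s.1 * s.2 := by simp [I]
  have WI : ∀ e ∈ I, Win X Y e := by
    intro e he
    have := (hI e).1 he
    unfold Win
    omega
  have hIr : ∀ k, k ∈ rect 6 6 s.1 s.2 ↔ ∃ c ∈ I, idx X Y c = k := by
    intro k
    rw [mem_rect]
    constructor
    · rintro ⟨y, hy, z, hz, rfl⟩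
      refine ⟨(X + z, Y + y), (hI _).2 ⟨?_, ?_, ?_, ?_⟩, ?_⟩
      · simp
      · simpa using hz
      · simp
      · simpa using hy
      · simp only [idx]; omega
    · rintro ⟨c, hc, rfl⟩
      have h1 := (hI c).1 hc
      refine ⟨(c.2 - Y).toNat, by omega, (c.1 - X).toNat, by omega, ?_⟩
      simp only [idx]; omega
  have hxor : (msk (rect 6 6 s.1 s.2)) ^^^ (mask X Y (I \ E)) = mask X Y E := by
    apply Nat.eq_of_testBit_eq
    intro k
    rw [Nat.testBit_xor]
    have hr := hIr k
    rw [← testBit_msk] at hr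
    have hD := testBit_mask (X := X) (Y := Y) (S := I \ E) (k := k)
    have hE' := testBit_mask (X := X) (Y := Y) (S := E) (k := k)
    by_cases h1 : ∃ c ∈ I, idx X Y c = k
    · obtain ⟨c, hc, hck⟩ := h1
      rw [hr.2 ⟨c, hc, hck⟩]
      by_cases h2 : c ∈ E
      · rw [hE'.2 ⟨c, h2, hck⟩]
        have : ¬ (mask X Y (I \ E)).testBit k = true := by
          rw [hD]
          rintro ⟨c', hc', hk'⟩
          have := idx_inj (WI c' (Finset.mem_sdiff.1 hc').1) (WI c hc) (hk'.trans hck.symm)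
          subst this
          exact (Finset.mem_sdiff.1 hc').2 h2
        rw [Bool.not_eq_true] at this
        rw [this]
        rfl
      · rw [hD.2 ⟨c, Finset.mem_sdiff.2 ⟨hc, h2⟩, hck⟩]
        have : ¬ (mask X Y E).testBit k = true := by
          rw [hE']
          rintro ⟨c', hc', hk'⟩
          have := idx_inj (WE c' hc') (WI c hc) (hk'.trans hck.symm)
          subst this
          exact h2 hc'
        rw [Bool.not_eq_true] at this
        rw [this]
        rfl
    · have a1 : ¬ (msk (rect 6 6 s.1 s.2)).testBit k = true := fun h => h1 (hr.1 h)
      have a2 : ¬ (mask X Y (I \ E)).testBit k = true := fun h => by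
        obtain ⟨c, hc, hk⟩ := hD.1 h
        exact h1 ⟨c, (Finset.mem_sdiff.1 hc).1, hk⟩
      have a3 : ¬ (mask X Y E).testBit k = true := fun h => by
        obtain ⟨c, hc, hk⟩ := hE'.1 h
        exact h1 ⟨c, hEI hc, hk⟩
      rw [Bool.not_eq_true] at a1 a2 a3
      rw [a1, a2, a3]
      rfl
  have hDm : mask X Y (I \ E) ∈ miss := by
    refine hmiss _ ?_ ?_
    · rw [Finset.card_sdiff_add_card_eq_card hEI, hIc]
    · intro c hc
      exact (hIr _).2 ⟨c, (Finset.mem_sdiff.1 hc).1, rfl⟩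
  unfold srchAll
  rw [List.any_eq_true]
  refine ⟨_, hDm, ?_⟩
  rw [List.any_eq_true]
  refine ⟨x, hx, ?_⟩
  have hxor' : Nat.xor (msk (rect 6 6 s.1 s.2)) (mask X Y (I \ E)) = mask X Y E := hxor
  rw [hxor']
  unfold srchE
  have hhit : ∀ i j, (apairs (p i) (p j)).Nonempty → hit (mask X Y (p i)) (mask X Y (p j)) = true := by
    rintro i j ⟨⟨a, b⟩, hab⟩
    simp only [apairs, mem_filter, mem_product] at hab
    obtain ⟨⟨ha, hb⟩, had⟩ := hab
    unfold hit
    rw [Bool.not_eq_true']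
    by_contra hne
    rw [Bool.not_eq_false, Nat.beq_eq] at hne
    have h1 : (nbm (mask X Y (p i))).testBit (idx X Y b) = true :=
      (nbm_mask (WF i)).2 ⟨a, ha, b - a, adj_dir had, by rw [add_sub_cancel]⟩
    have h2 : (mask X Y (p j)).testBit (idx X Y b) = true := testBit_mask.2 ⟨b, hb, rfl⟩
    have h3 := congrArg (fun n => Nat.testBit n (idx X Y b)) hne
    have h4 : (nbm (mask X Y (p i)) &&& mask X Y (p j)).testBit (idx X Y b) =
      Nat.testBit 0 (idx X Y b) := h3
    rw [Nat.testBit_and, h1, h2] at h4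
    simp at h4
  refine srch_sound (fun i => mask X Y (p i)) ?_ ?_ _ ?_ ?_ _ (fun _ => 0) ?_
  · intro i j hij
    refine and_zero_bits fun k h1 h2 => ?_
    obtain ⟨a, ha, hak⟩ := testBit_mask.1 h1
    obtain ⟨b, hb, hbk⟩ := testBit_mask.1 h2
    have := idx_inj (WF i a ha) (WF j b hb) (hak.trans hbk.symm)
    subst this
    exact Finset.disjoint_left.1 (hd i j hij) ha hb
  · unfold leafOk
    rw [Bool.or_eq_true]
    right
    rw [List.all_eq_true]
    intro i hi
    have hget : ∀ j : Fin 5, [mask X Y (p 0), mask X Y (p 1), mask X Y (p 2), mask X Y (p 3),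
        mask X Y (p 4)].getD j.val 0 = mask X Y (p j) := by
      intro j
      fin_cases j <;> rfl
    obtain ⟨j, k, hji, hki, hjk, h1, h2⟩ := hadj ⟨i, by simpa using hi⟩
    rw [List.any_eq_true]
    refine ⟨j.val, by simp, ?_⟩
    rw [List.any_eq_true]
    refine ⟨k.val, by simp, ?_⟩
    have hi' := hget ⟨i, by simpa using hi⟩
    simp only at hi'
    have ne : ∀ a b : ℕ, a ≠ b → (!(Nat.beq a b)) = true := by
      intro a b hab
      rw [Bool.not_eq_true']
      by_contra hne
      rw [Bool.not_eq_false, Nat.beq_eq] at hne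
      exact hab hne
    simp only [hget, hi', hhit _ _ h1, hhit _ _ h2, Bool.and_true]
    rw [ne _ _ (fun h => hji (Fin.ext h)), ne _ _ (fun h => hki (Fin.ext h)),
      ne _ _ (fun h => hjk (Fin.ext h))]
    rfl
  · intro i c _ hc
    obtain ⟨f, hf, t, hP⟩ := hpl i
    exact piece_base hf hP (WF i) hc
  · intro c hc
    rw [List.mem_filter, Bool.and_eq_true] at hc
    obtain ⟨-, h1, h2⟩ := hc
    obtain ⟨a, ha, d, hd', hk⟩ := (nbm_mask WE).1 h1
    have h3 : a + d ∉ E := by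
      intro h
      have h4 : (mask X Y E).testBit (Nat.add c 51) = true := testBit_mask.2 ⟨_, h, hk⟩
      rw [h4] at h2
      simp at h2
    obtain ⟨i, hi⟩ := hN a ha d hd' h3
    exact ⟨i, testBit_mask.2 ⟨_, hi, hk⟩⟩
  · intro i
    left
    refine ⟨rfl, and_zero_bits fun k h1 h2 => ?_⟩
    obtain ⟨a, ha, hak⟩ := testBit_mask.1 h1
    have h3 : (mask X Y E ||| ((2 ^ 256 - 1) ^^^ boxM s x)).testBit k = true := h2
    rw [Nat.testBit_or, Bool.or_eq_true, Nat.testBit_xor, Nat.testBit_two_pow_sub_one] at h3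
    rcases h3 with h3 | h3
    · obtain ⟨b, hb, hbk⟩ := testBit_mask.1 h3
      have := idx_inj (WF i a ha) (WE b hb) (hak.trans hbk.symm)
      subst this
      exact Finset.disjoint_left.1 (hdE i) ha hb
    · have hw := WF i a ha
      have hic := idx_cast hw
      obtain ⟨w1, w2, w3, w4⟩ := hw
      have hk : k < 256 := by omega
      have hbox : (boxM s x).testBit k = true := by
        unfold boxM
        rw [testBit_msk, mem_rect]
        have hc := hF i a ha
        refine ⟨(a.2 - (Y - 1 - x.2.2.1)).toNat, by omega, (a.1 - (X - 1 - x.1)).toNat,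
          by omega, by omega⟩
      rw [hbox] at h3
      simp [hk] at h3

end TFence

namespace TFence
open Finset

lemma final (F : TetFence) (h : ¬ F.area ≤ 9) : False := by
  classical
  have hpl : ∀ i, ∃ f ∈ symms, ∃ t : Cell, F.piece i = (fun c => f c + t) '' tets i :=
    F.placement
  choose f hf t hft using hpl
  let p : Fin 5 → Finset Cell := fun i => ((tetC i).image (f i)).image (· + t i)
  have hp : ∀ i, F.piece i = ↑(p i) := by
    intro i
    rw [hft i, tets_eq]
    simp only [p, Finset.coe_image, Set.image_image]
  have hpc : ∀ i, (p i).card = 4 := by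
    intro i
    rw [Finset.card_image_of_injective _ (add_left_injective _)]
    exact card_sym _ (hf i) i
  have hd : ∀ i j, i ≠ j → Disjoint (p i) (p j) := by
    intro i j hij
    have := F.disj hij
    simp only [hp, Finset.disjoint_coe] at this
    exact this
  have hadj : ∀ i, ∃ j k, j ≠ i ∧ k ≠ i ∧ j ≠ k ∧ (apairs (p i) (p j)).Nonempty ∧
      (apairs (p i) (p k)).Nonempty := by
    intro i
    have h2 := F.adj2 i
    obtain ⟨j, ⟨hj, hj'⟩, k, ⟨hk, hk'⟩, hjk⟩ := (Set.one_lt_ncard (Set.toFinite _)).1 h2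
    have conv : ∀ j, PieceAdj (F.piece i) (F.piece j) → (apairs (p i) (p j)).Nonempty := by
      rintro j ⟨a, ha, b, hb, hab⟩
      rw [hp] at ha hb
      exact ⟨(a, b), by simp only [apairs, mem_filter, mem_product]; exact ⟨⟨ha, hb⟩, hab⟩⟩
    exact ⟨j, k, hj, hk, hjk, conv j hj', conv k hk'⟩
  let U : Finset Cell := univ.biUnion p
  have hU : (⋃ i, F.piece i) = (U : Set Cell) := by
    ext c
    simp [U, hp]
  have hUc : U.card = 20 := by
    rw [Finset.card_biUnion (fun i _ j _ hij => hd i j hij)]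
    simp [hpc]
  have hper : per U ≤ 38 := by
    have h1 := per_add_apairs U
    have h2 := apairs_total p hd (fun i => (apairs_sym _ (hf i) i).trans (apairs_shift _ _)) hadj
    have h3 : 42 ≤ (apairs U U).card := h2
    omega
  have hconn : SetConnected (U : Set Cell) := hU ▸ F.conn
  have harea : F.area = Set.ncard {c | Enclosed (U : Set Cell) c} := by
    unfold TetFence.area encArea
    rw [hU]
  rw [harea] at h
  have hfin : {c | Enclosed (U : Set Cell) c}.Finite := Set.finite_of_ncard_pos (by omega)
  let E : Finset Cell := hfin.toFinset
  have hmE : ∀ c, c ∈ E ↔ Enclosed (U : Set Cell) c := by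
    intro c
    simp [E]
  have hEc : 10 ≤ E.card := by
    rw [Set.ncard_eq_toFinset_card _ hfin] at h
    change 10 ≤ hfin.toFinset.card
    omega
  have hdisj : Disjoint U E := by
    rw [Finset.disjoint_left]
    intro c hc hcE
    exact ((hmE c).1 hcE).1 hc
  have hE : ∀ c ∈ E, ∀ d ∈ dirs, c + d ∈ U ∪ E := by
    intro c hc d hd'
    rw [Finset.mem_union]
    by_cases hcd : c + d ∈ U
    · exact Or.inl hcd
    right
    obtain ⟨h1, h2⟩ := (hmE c).1 hc
    refine (hmE _).2 ⟨hcd, h2.subset ?_⟩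
    intro e he
    exact Relation.ReflTransGen.head ⟨adj_add hd', h1, hcd⟩ he
  obtain ⟨X, Y, s, hs, x, hx, hEb, hFb⟩ := reduce U E hdisj hE hper hUc hconn hEc
  have memU : ∀ i, ∀ c ∈ p i, c ∈ U := fun i c hc => Finset.mem_biUnion.2 ⟨i, mem_univ i, hc⟩
  have key : ∀ cells miss, s.1 ≤ 5 → s.2 ≤ 5 →
      (∀ D : Finset Cell, D.card + E.card = s.1 * s.2 →
        (∀ c ∈ D, idx X Y c ∈ rect 6 6 s.1 s.2) → mask X Y D ∈ miss) →
      srchAll s cells miss = true := by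
    intro cells miss h1 h2 h3
    refine instantiate X Y s h1 h2 x hx p E ?_ hd ?_ hadj ?_ hEb ?_ cells miss h3
    · intro i
      refine ⟨f i, hf i, t i, fun c => ?_⟩
      simp only [p, mem_image, exists_exists_and_eq_and]
    · intro i
      exact Finset.disjoint_of_subset_left (memU i) hdisj
    · intro c hc d hd' hcd
      rcases Finset.mem_union.1 (hE c hc d hd') with h | h
      · obtain ⟨i, -, hi⟩ := Finset.mem_biUnion.1 h
        exact ⟨i, hi⟩
      · exact absurd h hcd
    · intro i c hc
      exact hFb c (memU i c hc)
  have zero : ∀ D : Finset Cell, D.card = 0 → mask X Y D ∈ [0] := by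
    intro D hD
    rw [Finset.card_eq_zero.1 hD]
    simp [mask, msk]
  simp only [shapes, List.mem_cons, List.not_mem_nil, or_false] at hs
  rcases hs with rfl | rfl | rfl | rfl
  · have := key cells34 (smalls (rect 6 6 3 4)) (by norm_num) (by norm_num)
      (fun D h1 h2 => mem_smalls (by simp only at h1; omega) h2)
    rw [srch34] at this
    exact Bool.false_ne_true this
  · have := key cells43 (smalls (rect 6 6 4 3)) (by norm_num) (by norm_num)
      (fun D h1 h2 => mem_smalls (by simp only at h1; omega) h2)
    rw [srch43] at this
    exact Bool.false_ne_true this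
  · have := key cells25 [0] (by norm_num) (by norm_num)
      (fun D h1 h2 => zero D (by simp only at h1; omega))
    rw [srch25] at this
    exact Bool.false_ne_true this
  · have := key cells52 [0] (by norm_num) (by norm_num)
      (fun D h1 h2 => zero D (by simp only at h1; omega))
    rw [srch52] at this
    exact Bool.false_ne_true this

end TFence

/-- Every tetromino fence has enclosed area at most 9. -/
theorem tetromino_fence_area_le_nine (F : TetFence) : F.area ≤ 9 := by
  by_contra h
  exact TFence.final F h
end

section
/- There exists a tetromino fence whose enclosed area is exactly 9. -/
/-- The five placed pieces. -/
def pcs : Fin 5 → Finset Cell :=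
  ![{(5, 1), (5, 2), (5, 3), (5, 4)},
    {(0, 4), (0, 5), (1, 5), (2, 5)},
    {(0, 2), (0, 3), (1, 1), (1, 2)},
    {(3, 4), (3, 5), (4, 4), (4, 5)},
    {(2, 1), (3, 0), (3, 1), (4, 1)}]

/-- The union of the pieces. -/
def FF : Finset Cell := Finset.univ.biUnion pcs

/-- The enclosed cells. -/
def II : Finset Cell :=
  {(2, 2), (3, 2), (4, 2), (1, 3), (2, 3), (3, 3), (4, 3), (1, 4), (2, 4)}

/-- The four unit vectors. -/
def dirs : Finset Cell := {(1, 0), (-1, 0), (0, 1), (0, -1)}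

instance adjDec (p q : Cell) : Decidable (Adj p q) :=
  inferInstanceAs (Decidable ((p.1 - q.1).natAbs + (p.2 - q.2).natAbs = 1))

instance pieceAdjDec (A B : Finset Cell) : Decidable (PieceAdj (A : Set Cell) (B : Set Cell)) :=
  inferInstanceAs (Decidable (∃ a ∈ A, ∃ b ∈ B, Adj a b))

theorem adj_symm {p q : Cell} (h : Adj p q) : Adj q p := by
  unfold Adj at *; omega

theorem adj_add {p d : Cell} (h : d ∈ dirs) : Adj p (p + d) := by
  simp only [dirs, Finset.mem_insert, Finset.mem_singleton] at h
  rcases h with rfl | rfl | rfl | rfl <;> simp [Adj]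

theorem adj_dir {p q : Cell} (h : Adj p q) : ∃ d ∈ dirs, q = p + d := by
  refine ⟨q - p, ?_, by abel⟩
  obtain ⟨a, b⟩ := p
  obtain ⟨c, d⟩ := q
  simp only [Adj] at h
  simp only [dirs, Finset.mem_insert, Finset.mem_singleton, Prod.mk_sub_mk, Prod.mk.injEq]
  omega

theorem reach_symm {S : Set Cell} {p q : Cell} (h : ReachIn S p q) : ReachIn S q p := by
  unfold ReachIn at *
  induction h with
  | refl => exact .refl
  | tail _ h ih => exact .head ⟨adj_symm h.1, h.2.2, h.2.1⟩ ih

theorem union_eq : (⋃ i, (pcs i : Set Cell)) = (FF : Set Cell) := by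
  ext x; simp [FF]

/-- Breadth-first layers inside the fence. -/
def bfs : ℕ → Finset Cell
  | 0 => {(5, 1)}
  | n + 1 => bfs n ∪ FF.filter (fun y => ∃ x ∈ bfs n, Adj x y)

theorem bfs_reach (n : ℕ) : ∀ y ∈ bfs n, y ∈ FF ∧ ReachIn (FF : Set Cell) (5, 1) y := by
  induction n with
  | zero =>
    intro y hy
    simp only [bfs, Finset.mem_singleton] at hy
    subst hy
    exact ⟨by decide, .refl⟩
  | succ n ih =>
    intro y hy
    simp only [bfs, Finset.mem_union, Finset.mem_filter] at hy
    rcases hy with hy | ⟨hy, x, hx, hxy⟩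
    · exact ih y hy
    · exact ⟨hy, (ih x hx).2.tail ⟨hxy, (ih x hx).1, hy⟩⟩

theorem fence_conn : SetConnected (FF : Set Cell) := by
  have h : FF ⊆ bfs 12 := by decide +kernel
  intro p hp q hq
  exact (reach_symm (bfs_reach 12 p (h hp)).2).trans (bfs_reach 12 q (h hq)).2

theorem interior_closed : ∀ x ∈ II, ∀ d ∈ dirs, x + d ∈ FF ∨ x + d ∈ II := by decide +kernel

theorem interior_comp {c : Cell} (hc : c ∈ II) : component (FF : Set Cell)ᶜ c ⊆ II := by
  intro d hd
  change Relation.ReflTransGen _ c d at hd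
  induction hd with
  | refl => exact hc
  | tail _ h ih =>
    obtain ⟨e, he, rfl⟩ := adj_dir h.1
    exact (interior_closed _ ih e he).resolve_left h.2.2

theorem box_rays : ∀ a ∈ Finset.range 6, ∀ b ∈ Finset.range 6,
    ((a : ℤ), (b : ℤ)) ∈ FF ∨ ((a : ℤ), (b : ℤ)) ∈ II ∨
    ∃ d ∈ dirs, ∀ k ∈ Finset.range 6, (((a : ℤ), (b : ℤ)) : Cell) + ((k : ℤ) * d.1, (k : ℤ) * d.2) ∉ FF := by
  decide +kernel

theorem FF_box {p : Cell} (h : p ∈ FF) : 0 ≤ p.1 ∧ p.1 < 6 ∧ 0 ≤ p.2 ∧ p.2 < 6 := by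
  have : ∀ p ∈ FF, 0 ≤ p.1 ∧ p.1 < 6 ∧ 0 ≤ p.2 ∧ p.2 < 6 := by decide +kernel
  exact this p h

theorem ray {c : Cell} (h1 : c ∉ FF) (h2 : c ∉ II) :
    ∃ d ∈ dirs, ∀ k : ℕ, c + ((k : ℤ) * d.1, (k : ℤ) * d.2) ∉ FF := by
  obtain ⟨a, b⟩ := c
  by_cases hb : 0 ≤ a ∧ a < 6 ∧ 0 ≤ b ∧ b < 6
  · obtain ⟨ha, ha', hb, hb'⟩ := hb
    lift a to ℕ using ha
    lift b to ℕ using hb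
    have := box_rays a (by simp; omega) b (by simp; omega)
    obtain ⟨d, hd, hk⟩ := (this.resolve_left h1).resolve_left h2
    refine ⟨d, hd, fun k hm => ?_⟩
    by_cases hk6 : k < 6
    · exact hk k (by simpa using hk6) hm
    · have := FF_box hm
      simp only [dirs, Finset.mem_insert, Finset.mem_singleton] at hd
      rcases hd with rfl | rfl | rfl | rfl <;> simp at this <;> omega
  · have : a < 0 ∨ 6 ≤ a ∨ b < 0 ∨ 6 ≤ b := by omega
    rcases this with h | h | h | h
    · refine ⟨(-1, 0), by decide, fun k hm => ?_⟩
      have := FF_box hm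
      simp at this; omega
    · refine ⟨(1, 0), by decide, fun k hm => ?_⟩
      have := FF_box hm
      simp at this; omega
    · refine ⟨(0, -1), by decide, fun k hm => ?_⟩
      have := FF_box hm
      simp at this; omega
    · refine ⟨(0, 1), by decide, fun k hm => ?_⟩
      have := FF_box hm
      simp at this; omega

theorem exterior_inf {c : Cell} (h1 : c ∉ FF) (h2 : c ∉ II) :
    (component (FF : Set Cell)ᶜ c).Infinite := by
  obtain ⟨d, hd, hk⟩ := ray h1 h2
  refine Set.infinite_of_injective_forall_mem
    (f := fun k : ℕ => c + ((k : ℤ) * d.1, (k : ℤ) * d.2)) ?_ ?_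
  · intro k l hkl
    simp only [dirs, Finset.mem_insert, Finset.mem_singleton] at hd
    rcases hd with rfl | rfl | rfl | rfl <;> simpa using hkl
  · intro k
    change Relation.ReflTransGen _ _ _
    induction k with
    | zero =>
      have : c + (((0 : ℕ) : ℤ) * d.1, ((0 : ℕ) : ℤ) * d.2) = c := by ext <;> simp
      rw [this]
    | succ k ih =>
      refine ih.tail ⟨?_, hk k, hk (k + 1)⟩
      have : c + (((k + 1 : ℕ) : ℤ) * d.1, ((k + 1 : ℕ) : ℤ) * d.2)
          = c + ((k : ℤ) * d.1, (k : ℤ) * d.2) + d := by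
        ext <;> simp <;> ring
      rw [this]
      exact adj_add hd

theorem FF_area : encArea (FF : Set Cell) = 9 := by
  have : {c | Enclosed (FF : Set Cell) c} = (II : Set Cell) := by
    ext c
    constructor
    · rintro ⟨h1, h2⟩
      by_contra h
      exact exterior_inf h1 h h2
    · intro h
      have hd : ∀ c ∈ II, c ∉ FF := by decide +kernel
      exact ⟨hd c h, II.finite_toSet.subset (interior_comp h)⟩
  rw [encArea, this, Set.ncard_coe_finset]
  decide +kernel

theorem pcs_placement : ∀ i, IsPlacement (tets i) (pcs i : Set Cell) := by
  intro i
  fin_cases i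
  · refine ⟨fun p => (p.1, p.2), by simp [symms], (5, 1), ?_⟩
    simp [tets, pcs]
    ext ⟨x, y⟩; simp; omega
  · refine ⟨fun p => (p.2, -p.1), by simp [symms], (0, 5), ?_⟩
    simp [tets, pcs, Set.image_insert_eq]
    ext x; simp; tauto
  · refine ⟨fun p => (-p.2, p.1), by simp [symms], (1, 1), ?_⟩
    simp [tets, pcs, Set.image_insert_eq]
    ext x; simp; tauto
  · refine ⟨fun p => (p.1, p.2), by simp [symms], (3, 4), ?_⟩
    simp [tets, pcs]
    ext ⟨x, y⟩; simp; omega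
  · refine ⟨fun p => (-p.1, -p.2), by simp [symms], (4, 1), ?_⟩
    simp [tets, pcs, Set.image_insert_eq]
    ext x; simp; tauto

theorem pcs_adj2 (i : Fin 5) :
    2 ≤ Set.ncard {j | j ≠ i ∧ PieceAdj (pcs i : Set Cell) (pcs j : Set Cell)} := by
  have h : ∀ i : Fin 5, 2 ≤ (Finset.univ.filter
      (fun j => j ≠ i ∧ PieceAdj (pcs i : Set Cell) (pcs j : Set Cell))).card := by
    decide +kernel
  have := h i
  rw [← Set.ncard_coe_finset] at this
  simpa using this

/-- The fence. -/
def theFence : TetFence where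
  piece i := pcs i
  placement := pcs_placement
  disj := by
    have h : ∀ i j, i ≠ j → Disjoint (pcs i) (pcs j) := by decide +kernel
    intro i j hij
    exact Finset.disjoint_coe.2 (h i j hij)
  conn := by rw [union_eq]; exact fence_conn
  adj2 := pcs_adj2

/-- There exists a tetromino fence whose enclosed area is exactly 9. -/
theorem exists_tetromino_fence_area_nine : ∃ F : TetFence, F.area = 9 := by
  refine ⟨theFence, ?_⟩
  change encArea (⋃ i, (pcs i : Set Cell)) = 9
  rw [union_eq]
  exact FF_area
end
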